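/- Let S_PB := { x ∈ ℝⁿ : h_PB(x) = 0 }. Then for every x in the topological boundary ∂S_PB of S_PB, it holds that h̄_PB(x) = 0. -/

import Mathlib

/-- Closed-loop trajectory: `traj f x u 0 = x`, `traj f x u (i+1) = f (traj f x u i, u i)`. -/
noncomputable def traj {n m : ℕ}
    (f : EuclideanSpace ℝ (Fin n) × EuclideanSpace ℝ (Fin m) → EuclideanSpace ℝ (Fin n))
    (x : EuclideanSpace ℝ (Fin n)) (u : ℕ → EuclideanSpace ℝ (Fin m)) :
    ℕ → EuclideanSpace ℝ (Fin n)
  | 0 => x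
  | i + 1 => f (traj f x u i, u i)

/-- Soft-constrained PCBF cost of an input sequence `u`:
`α_f · max 0 (h_f x_N) + Σ_{i<N} ‖max 0 (c x_i + Δ_i 𝟙)‖` (componentwise max,
Euclidean norm). -/
noncomputable def pcbfCost {n m nc : ℕ} (N : ℕ)
    (f : EuclideanSpace ℝ (Fin n) × EuclideanSpace ℝ (Fin m) → EuclideanSpace ℝ (Fin n))
    (c : EuclideanSpace ℝ (Fin n) → EuclideanSpace ℝ (Fin nc)) (Δ : ℕ → ℝ)
    (hf : EuclideanSpace ℝ (Fin n) → ℝ) (αf : ℝ)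
    (x : EuclideanSpace ℝ (Fin n)) (u : ℕ → EuclideanSpace ℝ (Fin m)) : ℝ :=
  αf * max 0 (hf (traj f x u N)) +
    ∑ i ∈ Finset.range N,
      ‖((fun j => max 0 (c (traj f x u i) j + Δ i)) : Fin nc → ℝ)‖

/-- The PCBF `h_PB x`: infimum of `pcbfCost` over admissible input sequences. -/
noncomputable def hPB {n m nc : ℕ} (N : ℕ) (U : Set (EuclideanSpace ℝ (Fin m)))
    (f : EuclideanSpace ℝ (Fin n) × EuclideanSpace ℝ (Fin m) → EuclideanSpace ℝ (Fin n))
    (c : EuclideanSpace ℝ (Fin n) → EuclideanSpace ℝ (Fin nc)) (Δ : ℕ → ℝ)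
    (hf : EuclideanSpace ℝ (Fin n) → ℝ) (αf : ℝ) (x : EuclideanSpace ℝ (Fin n)) : ℝ :=
  sInf ((fun u => pcbfCost N f c Δ hf αf x u) '' {u | ∀ i < N, u i ∈ U})

/-- Cost of the extended value function: `max { max_{i<N, j} ([c x_i]_j + Δ_i), h_f x_N }`. -/
noncomputable def extCost {n m nc : ℕ} (N : ℕ)
    (f : EuclideanSpace ℝ (Fin n) × EuclideanSpace ℝ (Fin m) → EuclideanSpace ℝ (Fin n))
    (c : EuclideanSpace ℝ (Fin n) → EuclideanSpace ℝ (Fin nc)) (Δ : ℕ → ℝ)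
    (hf : EuclideanSpace ℝ (Fin n) → ℝ)
    (x : EuclideanSpace ℝ (Fin n)) (u : ℕ → EuclideanSpace ℝ (Fin m)) : ℝ :=
  max (⨆ q : Fin N × Fin nc, (c (traj f x u q.1) q.2 + Δ q.1)) (hf (traj f x u N))

/-- The extended value function `h̄_PB x` (slacks not sign-constrained). -/
noncomputable def hbarPB {n m nc : ℕ} (N : ℕ) (U : Set (EuclideanSpace ℝ (Fin m)))
    (f : EuclideanSpace ℝ (Fin n) × EuclideanSpace ℝ (Fin m) → EuclideanSpace ℝ (Fin n))
    (c : EuclideanSpace ℝ (Fin n) → EuclideanSpace ℝ (Fin nc)) (Δ : ℕ → ℝ)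
    (hf : EuclideanSpace ℝ (Fin n) → ℝ) (x : EuclideanSpace ℝ (Fin n)) : ℝ :=
  sInf ((fun u => extCost N f c Δ hf x u) '' {u | ∀ i < N, u i ∈ U})

section PredictiveBarrier

variable {n m nc N : ℕ} {U : Set (EuclideanSpace ℝ (Fin m))}
  {f : EuclideanSpace ℝ (Fin n) × EuclideanSpace ℝ (Fin m) → EuclideanSpace ℝ (Fin n)}
  {c : EuclideanSpace ℝ (Fin n) → EuclideanSpace ℝ (Fin nc)} {Δ : ℕ → ℝ}
  {hf : EuclideanSpace ℝ (Fin n) → ℝ} {αf : ℝ}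

theorem continuous_traj (hfc : Continuous f) (i : ℕ) :
    Continuous fun p : EuclideanSpace ℝ (Fin n) × (ℕ → EuclideanSpace ℝ (Fin m)) =>
      traj f p.1 p.2 i := by
  induction i with
  | zero => exact continuous_fst
  | succ i ih =>
    exact hfc.comp (ih.prodMk ((continuous_apply i).comp continuous_snd))

/-- The trajectory up to time `i` only depends on the inputs before time `i`. -/
theorem traj_congr {x : EuclideanSpace ℝ (Fin n)} {u v : ℕ → EuclideanSpace ℝ (Fin m)} {i : ℕ}
    (h : ∀ k < i, u k = v k) : traj f x u i = traj f x v i := by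
  induction i with
  | zero => rfl
  | succ i ih => rw [traj, traj, ih fun k hk => h k (by omega), h i (by omega)]

theorem continuous_pcbfCost (hfc : Continuous f) (hcc : Continuous c) (hfcont : Continuous hf) :
    Continuous fun p : EuclideanSpace ℝ (Fin n) × (ℕ → EuclideanSpace ℝ (Fin m)) =>
      pcbfCost N f c Δ hf αf p.1 p.2 := by
  have ht := continuous_traj hfc
  unfold pcbfCost
  refine (continuous_const.mul (continuous_const.max (hfcont.comp (ht N)))).add
    (continuous_finsetSum _ fun i _ => (continuous_pi fun j => ?_).norm)
  have hi := hcc.comp (ht i)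
  have hj := (EuclideanSpace.proj (𝕜 := ℝ) j).continuous.comp hi
  exact continuous_const.max (hj.add continuous_const)

theorem continuous_extCost (hN : 0 < N) (hnc : 0 < nc) (hfc : Continuous f) (hcc : Continuous c)
    (hfcont : Continuous hf) :
    Continuous fun p : EuclideanSpace ℝ (Fin n) × (ℕ → EuclideanSpace ℝ (Fin m)) =>
      extCost N f c Δ hf p.1 p.2 := by
  have : Nonempty (Fin N × Fin nc) := ⟨⟨0, hN⟩, ⟨0, hnc⟩⟩
  have ht := continuous_traj hfc
  unfold extCost
  simp_rw [← Finset.sup'_univ_eq_ciSup]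
  refine (Continuous.finset_sup'_apply _ fun q _ => ?_).max (hfcont.comp (ht N))
  exact ((EuclideanSpace.proj (𝕜 := ℝ) q.2).continuous.comp (hcc.comp (ht q.1))).add
    continuous_const

theorem pcbfCost_nonneg (hαf : 0 < αf) (x : EuclideanSpace ℝ (Fin n))
    (u : ℕ → EuclideanSpace ℝ (Fin m)) : 0 ≤ pcbfCost N f c Δ hf αf x u := by
  unfold pcbfCost
  positivity

/-- Zero soft-constrained cost and nonpositive extended cost both mean that all constraints
hold along the trajectory. -/
theorem pcbfCost_eq_zero_iff (hN : 0 < N) (hnc : 0 < nc) (hαf : 0 < αf)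
    (x : EuclideanSpace ℝ (Fin n)) (u : ℕ → EuclideanSpace ℝ (Fin m)) :
    pcbfCost N f c Δ hf αf x u = 0 ↔ extCost N f c Δ hf x u ≤ 0 := by
  have : Nonempty (Fin N × Fin nc) := ⟨⟨0, hN⟩, ⟨0, hnc⟩⟩
  unfold pcbfCost extCost
  rw [add_eq_zero_iff_of_nonneg (by positivity) (by positivity),
    Finset.sum_eq_zero_iff_of_nonneg fun _ _ => norm_nonneg _, max_le_iff,
    ciSup_le_iff (Set.finite_range _).bddAbove, and_comm]
  simp only [norm_eq_zero, funext_iff, Pi.zero_apply, max_eq_left_iff, Finset.mem_range,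
    mul_eq_zero, hαf.ne', false_or, Prod.forall, Fin.forall_iff (n := N)]

/-- Inputs after the horizon are irrelevant, so they may be required to lie in `U` too. -/
theorem image_horizon_eq {g : (ℕ → EuclideanSpace ℝ (Fin m)) → ℝ} (hUne : U.Nonempty)
    (hg : ∀ u v, (∀ i < N, u i = v i) → g u = g v) :
    g '' {u | ∀ i < N, u i ∈ U} = g '' Set.univ.pi fun _ => U := by
  obtain ⟨w, hw⟩ := hUne
  apply Set.Subset.antisymm
  · rintro _ ⟨u, hu, rfl⟩
    refine ⟨fun i => if i < N then u i else w, fun i _ => ?_, hg _ _ fun i hi => if_pos hi⟩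
    by_cases hi : i < N
    · simpa [hi] using hu i hi
    · simpa [hi] using hw
  · exact Set.image_mono fun u hu i _ => hu i trivial

theorem hPB_eq_sInf_pi (hUne : U.Nonempty) (x : EuclideanSpace ℝ (Fin n)) :
    hPB N U f c Δ hf αf x = sInf (pcbfCost N f c Δ hf αf x '' Set.univ.pi fun _ => U) := by
  refine congrArg sInf (image_horizon_eq hUne fun u v h => ?_)
  unfold pcbfCost
  rw [traj_congr h]
  congr 1
  refine Finset.sum_congr rfl fun i hi => ?_
  rw [traj_congr fun k hk => h k (hk.trans (Finset.mem_range.1 hi))]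

theorem hbarPB_eq_sInf_pi (hUne : U.Nonempty) (x : EuclideanSpace ℝ (Fin n)) :
    hbarPB N U f c Δ hf x = sInf (extCost N f c Δ hf x '' Set.univ.pi fun _ => U) := by
  refine congrArg sInf (image_horizon_eq hUne fun u v h => ?_)
  unfold extCost
  rw [traj_congr h]
  congr 2
  funext q
  rw [traj_congr fun k hk => h k (hk.trans q.1.2)]

theorem continuous_hbarPB (hN : 0 < N) (hnc : 0 < nc) (hUcomp : IsCompact U) (hUne : U.Nonempty)
    (hfc : Continuous f) (hcc : Continuous c) (hfcont : Continuous hf) :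
    Continuous (hbarPB N U f c Δ hf) := by
  rw [funext (hbarPB_eq_sInf_pi hUne)]
  exact (isCompact_univ_pi fun _ => hUcomp).continuous_sInf
    (continuous_extCost hN hnc hfc hcc hfcont)

/-- The safe set is the zero sublevel set of the extended value function. -/
theorem hPB_eq_zero_iff (hN : 0 < N) (hnc : 0 < nc) (hUcomp : IsCompact U) (hUne : U.Nonempty)
    (hfc : Continuous f) (hcc : Continuous c) (hfcont : Continuous hf) (hαf : 0 < αf)
    (x : EuclideanSpace ℝ (Fin n)) :
    hPB N U f c Δ hf αf x = 0 ↔ hbarPB N U f c Δ hf x ≤ 0 := by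
  have hK : IsCompact (Set.univ.pi fun _ : ℕ => U) := isCompact_univ_pi fun _ => hUcomp
  have hKne : (Set.univ.pi fun _ : ℕ => U).Nonempty := Set.univ_pi_nonempty_iff.2 fun _ => hUne
  have hcont : Continuous (extCost N f c Δ hf x) :=
    (continuous_extCost hN hnc hfc hcc hfcont).comp (Continuous.prodMk_right x)
  have hcont' : Continuous (pcbfCost N f c Δ hf αf x) :=
    (continuous_pcbfCost hfc hcc hfcont).comp (Continuous.prodMk_right x)
  rw [hPB_eq_sInf_pi hUne, hbarPB_eq_sInf_pi hUne]
  constructor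
  · intro h
    obtain ⟨u, hu, hux⟩ := hK.exists_sInf_image_eq hKne hcont'.continuousOn
    exact (csInf_le (hK.image hcont).bddBelow ⟨u, hu, rfl⟩).trans
      ((pcbfCost_eq_zero_iff hN hnc hαf x u).1 (hux.symm.trans h))
  · intro h
    obtain ⟨u, hu, hux⟩ := hK.exists_sInf_image_eq hKne hcont.continuousOn
    have h0 := (pcbfCost_eq_zero_iff hN hnc hαf x u).2 (hux.symm.trans_le h)
    refine le_antisymm ((csInf_le (hK.image hcont').bddBelow ⟨u, hu, rfl⟩).trans h0.le)
      (Real.sInf_nonneg ?_)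
    rintro _ ⟨v, -, rfl⟩
    exact pcbfCost_nonneg hαf x v

end PredictiveBarrier

/-- On the topological boundary of the safe set `S_PB = {x : h_PB x = 0}`, the extended
value function vanishes: `h̄_PB x = 0`. -/
theorem stmt13
    {n m nc N : ℕ} (hN : 0 < N) (hnc : 0 < nc)
    (U : Set (EuclideanSpace ℝ (Fin m))) (hUcomp : IsCompact U) (hUne : U.Nonempty)
    (f : EuclideanSpace ℝ (Fin n) × EuclideanSpace ℝ (Fin m) → EuclideanSpace ℝ (Fin n))
    (hfc : Continuous f)
    (c : EuclideanSpace ℝ (Fin n) → EuclideanSpace ℝ (Fin nc)) (hcc : Continuous c)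
    (Δ : ℕ → ℝ)
    (hf : EuclideanSpace ℝ (Fin n) → ℝ) (hfcont : Continuous hf)
    (αf : ℝ) (hαf : 0 < αf) :
    ∀ x ∈ frontier {y : EuclideanSpace ℝ (Fin n) | hPB N U f c Δ hf αf y = 0},
      hbarPB N U f c Δ hf x = 0 := by
  intro x hx
  simp_rw [hPB_eq_zero_iff hN hnc hUcomp hUne hfc hcc hfcont hαf] at hx
  exact frontier_le_subset_eq (continuous_hbarPB hN hnc hUcomp hUne hfc hcc hfcont)
    continuous_const hx
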